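/- Let l, l' ≥ 1, let ξ ∈ V_l ⊖ S_l and ξ' ∈ V_{l'} ⊖ S_{l'}, and suppose ⟨ξ, ξ'⟩ = 0. Then ⟨ξ_{m,n}, ξ'_{r,s}⟩ = 0 for all integers m, n, r, s ≥ 0; in other words, the closed subspaces spanned by {ξ_{m,n} : m, n ≥ 0} and by {ξ'_{r,s} : r, s ≥ 0} are orthogonal. -/

import Mathlib

noncomputable section

open scoped ComplexInnerProductSpace

namespace UCoxMasa

/-- The universal Coxeter matrix on `Fin L`: all off-diagonal entries are `0` (representing ∞). -/
def Mat (L : ℕ) : CoxeterMatrix (Fin L) where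
  M := fun i j => if i = j then 1 else 0
  isSymm := by
    ext i j
    by_cases h : i = j <;> simp [Matrix.transpose, h, eq_comm]
  diagonal := fun i => by simp
  off_diagonal := fun i j h => by simp [h]

/-- The universal Coxeter group on `L` generators: free product of `L` copies of `ℤ/2ℤ`. -/
abbrev W (L : ℕ) : Type := (Mat L).Group

/-- The distinguished Coxeter system of `W L`. -/
def cs (L : ℕ) : CoxeterSystem (Mat L) (W L) := CoxeterMatrix.toCoxeterSystem (Mat L)

/-- The simple reflection associated to `i : Fin L`. -/
def σ {L : ℕ} (i : Fin L) : W L := (cs L).simple i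

/-- Word length on `W L` with respect to the generating set of simple reflections. -/
def len {L : ℕ} (w : W L) : ℕ := (cs L).length w

/-- The Hilbert space `ℓ²(W)`. -/
abbrev H (L : ℕ) : Type := lp (fun _ : W L => ℂ) 2

/-- The standard orthonormal basis vector `δ_w` of `ℓ²(W)`. -/
def δ {L : ℕ} (w : W L) : H L :=
  letI := Classical.decEq (W L)
  lp.single 2 w 1

/-- `V l`: the linear span of `{δ_w : ℓ(w) = l}`. -/
def V (L : ℕ) (l : ℕ) : Submodule ℂ (H L) :=
  Submodule.span ℂ {x : H L | ∃ w : W L, len w = l ∧ x = δ w}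

/-- `S_l`: the linear span of `q_l(h V_{l-1}) ∪ q_l(R_h V_{l-1})`,
given the projections `Q`, the operator `h` and the right operator `Rh`. -/
def Sl (L : ℕ) (Q : ℕ → (H L →L[ℂ] H L)) (h Rh : H L →L[ℂ] H L) (l : ℕ) :
    Submodule ℂ (H L) :=
  Submodule.span ℂ
    ({x : H L | ∃ y ∈ V L (l - 1), x = Q l (h y)} ∪
      {x : H L | ∃ y ∈ V L (l - 1), x = Q l (Rh y)})

end UCoxMasa

namespace UCoxMasa

variable {L : ℕ}

/-! ### Normal forms in the universal Coxeter group -/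

/-- Words without two equal adjacent letters. -/
abbrev NormalForm (L : ℕ) : Type := {l : List (Fin L) // l.IsChain (· ≠ ·)}

/-- Left multiplication of a normal form by a letter. -/
def NormalForm.mulLeft (s : Fin L) : NormalForm L → NormalForm L
  | ⟨[], _⟩ => ⟨[s], List.isChain_singleton s⟩
  | ⟨t :: l, hl⟩ =>
    if h : s = t then ⟨l, hl.tail⟩ else ⟨s :: t :: l, List.isChain_cons_cons.2 ⟨h, hl⟩⟩

lemma NormalForm.mulLeft_mulLeft (s : Fin L) (x : NormalForm L) :
    mulLeft s (mulLeft s x) = x := by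
  obtain ⟨l, hl⟩ := x
  match l, hl with
  | [], _ => simp [mulLeft]
  | [t], _ => by_cases h : s = t <;> simp [mulLeft, h]
  | t :: t' :: l, hl =>
    by_cases h : s = t
    · have := (List.isChain_cons_cons.1 hl).1
      subst h
      simp [mulLeft, this]
    · simp [mulLeft, h]

lemma NormalForm.wordProd_mulLeft (s : Fin L) (x : NormalForm L) :
    (cs L).wordProd (mulLeft s x).1 = σ s * (cs L).wordProd x.1 := by
  obtain ⟨l, hl⟩ := x
  match l, hl with
  | [], _ => simp [mulLeft, σ]
  | t :: l, hl =>
    by_cases h : s = t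
    · subst h
      simp [mulLeft, σ, CoxeterSystem.wordProd_cons]
    · simp [mulLeft, σ, h, CoxeterSystem.wordProd_cons]

lemma NormalForm.length_mulLeft_le (s : Fin L) (x : NormalForm L) :
    (mulLeft s x).1.length ≤ x.1.length + 1 := by
  obtain ⟨l, hl⟩ := x
  match l, hl with
  | [], _ => simp [mulLeft]
  | t :: l, hl => by_cases h : s = t <;> simp [mulLeft, h]; omega

lemma NormalForm.head?_eq_of_length_mulLeft_lt {s : Fin L} {x : NormalForm L}
    (h : (mulLeft s x).1.length < x.1.length) : x.1.head? = some s := by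
  obtain ⟨l, hl⟩ := x
  match l, hl with
  | [], _ => simp at h
  | t :: l, hl =>
    by_cases h' : s = t
    · simp [h']
    · simp [mulLeft, h'] at h

/-- The left multiplication by a letter, as an element of the monoid of self-maps. -/
def mulLeftEnd (s : Fin L) : Function.End (NormalForm L) := NormalForm.mulLeft s

lemma isLiftable_mulLeftEnd : (Mat L).IsLiftable (mulLeftEnd (L := L)) := by
  intro i j
  by_cases h : i = j
  · subst h
    have : (Mat L) i i = 1 := (Mat L).diagonal i
    rw [this, pow_one]
    funext x
    exact NormalForm.mulLeft_mulLeft i x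
  · have : (Mat L) i j = 0 := if_neg h
    rw [this, pow_zero]

/-- The action of the group on normal forms. -/
def normalFormHom (L : ℕ) : W L →* Function.End (NormalForm L) :=
  (cs L).lift ⟨mulLeftEnd, isLiftable_mulLeftEnd⟩

lemma normalFormHom_simple (s : Fin L) : normalFormHom L (σ s) = mulLeftEnd s :=
  (cs L).lift_apply_simple isLiftable_mulLeftEnd s

/-- The normal form of a group element. -/
def normalForm (w : W L) : NormalForm L := normalFormHom L w ⟨[], List.isChain_nil⟩

lemma normalForm_one : normalForm (1 : W L) = ⟨[], List.isChain_nil⟩ := by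
  rw [normalForm, map_one]
  rfl

lemma normalForm_simple_mul (s : Fin L) (w : W L) :
    normalForm (σ s * w) = NormalForm.mulLeft s (normalForm w) := by
  rw [normalForm, map_mul, normalFormHom_simple]
  rfl

lemma wordProd_normalForm (w : W L) : (cs L).wordProd (normalForm w).1 = w := by
  induction w using (cs L).simple_induction_left with
  | one => simp [normalForm_one]
  | mul_simple_left w i ih =>
    change (cs L).wordProd (normalForm (σ i * w)).1 = _
    rw [normalForm_simple_mul, NormalForm.wordProd_mulLeft, ih]
    rfl

lemma len_eq_length_normalForm (w : W L) : len w = (normalForm w).1.length := by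
  apply le_antisymm
  · conv_lhs => rw [← wordProd_normalForm w]
    exact (cs L).length_wordProd_le _
  · obtain ⟨ω, hω, rfl⟩ := (cs L).exists_isReduced w
    rw [len, hω.eq]
    clear hω
    induction ω with
    | nil => simp [normalForm_one]
    | cons s ω ih =>
      rw [CoxeterSystem.wordProd_cons]
      change (normalForm (σ s * _)).1.length ≤ _
      rw [normalForm_simple_mul]
      exact (NormalForm.length_mulLeft_le _ _).trans (by simpa using ih)

lemma leftDescent_unique {s t : Fin L} {w : W L} (hs : len (σ s * w) < len w)
    (ht : len (σ t * w) < len w) : s = t := by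
  simp only [len_eq_length_normalForm, normalForm_simple_mul] at hs ht
  have h1 := NormalForm.head?_eq_of_length_mulLeft_lt hs
  have h2 := NormalForm.head?_eq_of_length_mulLeft_lt ht
  exact Option.some.inj (h1.symm.trans h2)

/-! ### Lengths and descents -/

lemma len_simple_mul (s : Fin L) (w : W L) :
    len (σ s * w) = len w + 1 ∨ len (σ s * w) + 1 = len w := (cs L).length_simple_mul w s

lemma len_mul_simple (w : W L) (s : Fin L) :
    len (w * σ s) = len w + 1 ∨ len (w * σ s) + 1 = len w := (cs L).length_mul_simple w s

@[simp] lemma len_inv (w : W L) : len w⁻¹ = len w := (cs L).length_inv w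

@[simp] lemma len_one : len (1 : W L) = 0 := (cs L).length_one

lemma len_eq_zero_iff {w : W L} : len w = 0 ↔ w = 1 := (cs L).length_eq_zero_iff

lemma len_mul_le (v w : W L) : len (v * w) ≤ len v + len w := (cs L).length_mul_le v w

@[simp] lemma simple_mul_cancel (s : Fin L) (w : W L) : σ s * (σ s * w) = w :=
  (cs L).simple_mul_simple_cancel_left s

@[simp] lemma mul_simple_cancel (w : W L) (s : Fin L) : w * σ s * σ s = w :=
  (cs L).simple_mul_simple_cancel_right s

@[simp] lemma simple_inv (s : Fin L) : (σ s)⁻¹ = σ s := (cs L).inv_simple s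

lemma exists_leftDescent {w : W L} (hw : len w ≠ 0) : ∃ s, len (σ s * w) < len w :=
  (cs L).exists_leftDescent_of_ne_one fun h => hw (len_eq_zero_iff.2 h)

lemma len_eq_zero_of_exchange {s t : Fin L} {w : W L} (hs : len w < len (σ s * w))
    (ht : len w < len (w * σ t)) (hst : len (σ s * (w * σ t)) < len (w * σ t)) :
    len w = 0 := by
  by_contra hw
  obtain ⟨r, hr⟩ := exists_leftDescent hw
  have h1 : len (σ r * (w * σ t)) < len (w * σ t) := by
    have h2 := len_mul_simple (σ r * w) t
    rw [mul_assoc] at h2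
    omega
  obtain rfl := leftDescent_unique hst h1
  omega

lemma len_eq_one_of_exchange {s t : Fin L} {w : W L} (hs : len (σ s * w) < len w)
    (ht : len (w * σ t) < len w) (hst : len (σ s * w) < len (σ s * w * σ t)) :
    len w = 1 := by
  have h1 := len_mul_simple (σ s * w) t
  have h2 := len_mul_simple w t
  have h3 := len_simple_mul s w
  have := len_eq_zero_of_exchange (s := s) (t := t) (w := σ s * w) (by simpa using hs) hst
    (by rw [mul_assoc, simple_mul_cancel, ← mul_assoc]; omega)
  omega

instance finite_sphere (n : ℕ) : Finite {w : W L // len w = n} := by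
  refine Finite.of_surjective
    (α := {ω : List.Vector (Fin L) n // len ((cs L).wordProd ω.1) = n})
    (fun ω => ⟨(cs L).wordProd ω.1.1, ω.2⟩) ?_
  rintro ⟨w, hw⟩
  obtain ⟨ω, hω, rfl⟩ := (cs L).exists_isReduced w
  exact ⟨⟨⟨ω, hω.eq.symm.trans hw⟩, hw⟩, rfl⟩

/-! ### Raising and lowering operators on finitely supported functions -/

/-- Finitely supported functions on the group. -/
abbrev F (L : ℕ) : Type := W L →₀ ℂ

/-- The functions supported on the sphere of radius `k`. -/
abbrev sphere (L k : ℕ) : Submodule ℂ (F L) := Finsupp.supported ℂ ℂ {w : W L | len w = k}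

/-- The part of left multiplication by the sum of the generators which increases the length. -/
def raise : F L →ₗ[ℂ] F L := Finsupp.linearCombination ℂ fun w : W L =>
  ∑ s, if len w < len (σ s * w) then Finsupp.single (σ s * w) (1 : ℂ) else 0

/-- The part of left multiplication by the sum of the generators which decreases the length. -/
def lower : F L →ₗ[ℂ] F L := Finsupp.linearCombination ℂ fun w : W L =>
  ∑ s, if len (σ s * w) < len w then Finsupp.single (σ s * w) (1 : ℂ) else 0

/-- Precomposition with inversion in the group. -/
def flip : F L →ₗ[ℂ] F L := Finsupp.linearCombination ℂ fun w : W L => Finsupp.single w⁻¹ (1 : ℂ)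

/-- The right-handed version of `raise`. -/
def raiseR : F L →ₗ[ℂ] F L := flip ∘ₗ raise ∘ₗ flip

/-- The right-handed version of `lower`. -/
def lowerR : F L →ₗ[ℂ] F L := flip ∘ₗ lower ∘ₗ flip

/-- The map from finitely supported functions to `ℓ²`. -/
def toH : F L →ₗ[ℂ] H L := Finsupp.linearCombination ℂ δ

@[simp] lemma toH_single (w : W L) : toH (Finsupp.single w 1) = δ w := by simp [toH]

@[simp] lemma flip_single (w : W L) : flip (Finsupp.single w (1 : ℂ)) = Finsupp.single w⁻¹ 1 := by
  simp [flip]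

lemma raise_single (w : W L) : raise (Finsupp.single w (1 : ℂ)) =
    ∑ s, if len w < len (σ s * w) then Finsupp.single (σ s * w) (1 : ℂ) else 0 := by
  simp [raise]

lemma lower_single (w : W L) : lower (Finsupp.single w (1 : ℂ)) =
    ∑ s, if len (σ s * w) < len w then Finsupp.single (σ s * w) (1 : ℂ) else 0 := by
  simp [lower]

lemma len_simple_mul_inv (s : Fin L) (w : W L) : len (σ s * w⁻¹) = len (w * σ s) := by
  rw [← len_inv]; simp

lemma raiseR_single (w : W L) : raiseR (Finsupp.single w (1 : ℂ)) =
    ∑ s, if len w < len (w * σ s) then Finsupp.single (w * σ s) (1 : ℂ) else 0 := by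
  simp [raiseR, raise_single, apply_ite flip, len_simple_mul_inv]

lemma flip_flip (f : F L) : flip (flip f) = f := by
  induction f using Finsupp.induction_linear with
  | zero => simp
  | add f g hf hg => simp [hf, hg]
  | single w c => simp [flip]

lemma eq_of_mem_sphere {M : Type*} [AddCommMonoid M] [Module ℂ M] {A B : F L →ₗ[ℂ] M} {k : ℕ}
    (h : ∀ w : W L, len w = k → A (Finsupp.single w 1) = B (Finsupp.single w 1)) {f : F L}
    (hf : f ∈ sphere L k) : A f = B f := by
  rw [sphere, Finsupp.supported_eq_span_single] at hf
  refine LinearMap.eqOn_span' ?_ hf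
  rintro _ ⟨w, hw, rfl⟩
  exact h w hw

lemma map_mem_of_mem_sphere {M : Type*} [AddCommMonoid M] [Module ℂ M] {A : F L →ₗ[ℂ] M} {k : ℕ}
    {N : Submodule ℂ M} (h : ∀ w : W L, len w = k → A (Finsupp.single w 1) ∈ N) {f : F L}
    (hf : f ∈ sphere L k) : A f ∈ N := by
  rw [sphere, Finsupp.supported_eq_span_single] at hf
  suffices Submodule.span ℂ _ ≤ N.comap A from this hf
  rw [Submodule.span_le]
  rintro _ ⟨w, hw, rfl⟩
  exact h w hw

lemma single_mem_sphere {w : W L} {k : ℕ} (h : len w = k) :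
    Finsupp.single w (1 : ℂ) ∈ sphere L k :=
  Finsupp.single_mem_supported ℂ 1 h

lemma flip_mem_sphere {k : ℕ} {f : F L} (hf : f ∈ sphere L k) : flip f ∈ sphere L k :=
  map_mem_of_mem_sphere (fun w hw => by
    rw [flip_single]; exact single_mem_sphere (by simpa using hw)) hf

lemma raise_mem_sphere {k : ℕ} {f : F L} (hf : f ∈ sphere L k) : raise f ∈ sphere L (k + 1) :=
  map_mem_of_mem_sphere (fun w hw => by
    rw [raise_single]
    refine Submodule.sum_mem _ fun s _ => ?_
    split_ifs with h
    · exact single_mem_sphere (by have := len_simple_mul s w; omega)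
    · exact zero_mem _) hf

lemma lower_mem_sphere {k : ℕ} {f : F L} (hf : f ∈ sphere L (k + 1)) : lower f ∈ sphere L k :=
  map_mem_of_mem_sphere (fun w hw => by
    rw [lower_single]
    refine Submodule.sum_mem _ fun s _ => ?_
    split_ifs with h
    · exact single_mem_sphere (by have := len_simple_mul s w; omega)
    · exact zero_mem _) hf

lemma raiseR_mem_sphere {k : ℕ} {f : F L} (hf : f ∈ sphere L k) : raiseR f ∈ sphere L (k + 1) :=
  flip_mem_sphere (raise_mem_sphere (flip_mem_sphere hf))

lemma lowerR_mem_sphere {k : ℕ} {f : F L} (hf : f ∈ sphere L (k + 1)) : lowerR f ∈ sphere L k :=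
  flip_mem_sphere (lower_mem_sphere (flip_mem_sphere hf))

lemma raise_pow_mem_sphere {k : ℕ} {f : F L} (hf : f ∈ sphere L k) (m : ℕ) :
    (raise ^ m) f ∈ sphere L (m + k) := by
  induction m with
  | zero => simpa using hf
  | succ m ih =>
    rw [pow_succ', Module.End.mul_apply, add_right_comm]
    exact raise_mem_sphere ih

lemma raiseR_pow_mem_sphere {k : ℕ} {f : F L} (hf : f ∈ sphere L k) (m : ℕ) :
    (raiseR ^ m) f ∈ sphere L (m + k) := by
  induction m with
  | zero => simpa using hf
  | succ m ih =>
    rw [pow_succ', Module.End.mul_apply, add_right_comm]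
    exact raiseR_mem_sphere ih

lemma raiseR_pow (n : ℕ) (f : F L) : (raiseR ^ n) f = flip ((raise ^ n) (flip f)) := by
  induction n with
  | zero => simp [flip_flip]
  | succ n ih =>
    rw [pow_succ', pow_succ', Module.End.mul_apply, Module.End.mul_apply, ih]
    simp [raiseR, flip_flip]

lemma map_sum_ite {A : F L →ₗ[ℂ] F L} {a : Fin L → Prop} {b : Fin L → Fin L → Prop}
    [DecidablePred a] [∀ t, DecidablePred (b t)] {x : Fin L → F L} {y : Fin L → Fin L → F L}
    (h : ∀ t, A (x t) = ∑ s, if b t s then y t s else 0) :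
    A (∑ t, if a t then x t else 0) = ∑ t, ∑ s, if a t ∧ b t s then y t s else 0 := by
  rw [map_sum]
  refine Finset.sum_congr rfl fun t _ => ?_
  by_cases ha : a t <;> simp [ha, h]

lemma raise_raiseR_comm : Commute (raise : Module.End ℂ (F L)) raiseR := by
  refine Finsupp.lhom_ext' fun w => LinearMap.ext_ring ?_
  change raise (raiseR (Finsupp.single w 1)) = raiseR (raise (Finsupp.single w 1))
  rw [raise_single, raiseR_single, map_sum_ite fun t => raise_single (w * σ t),
    map_sum_ite fun s => raiseR_single (σ s * w), Finset.sum_comm]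
  refine Finset.sum_congr rfl fun s _ => Finset.sum_congr rfl fun t _ => ?_
  rw [mul_assoc]
  refine if_congr ?_ rfl rfl
  have h1 := len_simple_mul s w
  have h2 := len_mul_simple w t
  have h3 := len_simple_mul s (w * σ t)
  have h4 := len_mul_simple (σ s * w) t
  rw [mul_assoc] at h4
  omega

lemma lower_raiseR_of_two_le {k : ℕ} (hk : 2 ≤ k) {f : F L} (hf : f ∈ sphere L k) :
    lower (raiseR f) = raiseR (lower f) := by
  refine eq_of_mem_sphere (A := lower ∘ₗ raiseR) (B := raiseR ∘ₗ lower) ?_ hf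
  intro w hw
  change lower (raiseR (Finsupp.single w 1)) = raiseR (lower (Finsupp.single w 1))
  rw [lower_single, raiseR_single, map_sum_ite fun t => lower_single (w * σ t),
    map_sum_ite fun s => raiseR_single (σ s * w), Finset.sum_comm]
  refine Finset.sum_congr rfl fun s _ => Finset.sum_congr rfl fun t _ => ?_
  have h1 := len_simple_mul s w
  have h2 := len_mul_simple w t
  have h3 := len_simple_mul s (w * σ t)
  have h4 := len_mul_simple (σ s * w) t
  have h5 := len_eq_zero_of_exchange (s := s) (t := t) (w := w)
  have h6 := len_eq_one_of_exchange (s := s) (t := t) (w := w)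
  rw [mul_assoc] at *
  refine if_congr ?_ rfl rfl
  omega

lemma lower_raiseR_of_eq_one {f : F L} (hf : f ∈ sphere L 1) :
    lower (raiseR f) = raiseR (lower f) - f := by
  refine eq_of_mem_sphere (A := lower ∘ₗ raiseR) (B := raiseR ∘ₗ lower - LinearMap.id) ?_ hf
  intro w hw
  change lower (raiseR (Finsupp.single w 1)) =
    raiseR (lower (Finsupp.single w 1)) - Finsupp.single w 1
  obtain ⟨r, rfl⟩ := (cs L).length_eq_one_iff.1 hw
  change lower (raiseR (Finsupp.single (σ r) 1)) =
    raiseR (lower (Finsupp.single (σ r) 1)) - Finsupp.single (σ r) 1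
  have hlen : ∀ t : Fin L, len (σ t) = 1 := (cs L).length_simple
  have hlower : ∀ (t : Fin L) (v : W L), len v < len (σ t * v) →
      lower (Finsupp.single (σ t * v) (1 : ℂ)) = Finsupp.single v 1 := by
    intro t v hv
    rw [lower_single, Finset.sum_eq_single t]
    · simp [hv]
    · intro u _ hu
      exact if_neg fun h => hu (leftDescent_unique h (by simpa using hv))
    · simp
  have hone : lower (Finsupp.single (σ r) (1 : ℂ)) = Finsupp.single 1 1 := by
    simpa using hlower r 1 (by simp [hlen])
  have hterm : ∀ t, (if len (σ r) < len (σ r * σ t) then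
      lower (Finsupp.single (σ r * σ t) (1 : ℂ)) else 0)
      = Finsupp.single (σ t) 1 - if t = r then Finsupp.single (σ r) 1 else 0 := by
    intro t
    by_cases ht : t = r
    · subst ht
      have : σ t * σ t = 1 := (cs L).simple_mul_simple_self t
      simp [this]
    · have h1 : len (σ r) < len (σ r * σ t) := by
        have h2 := len_simple_mul r (σ t)
        have h3 : ¬ len (σ r * σ t) < len (σ t) := fun h =>
          ht (leftDescent_unique (w := σ t) (by
            have : σ t * σ t = 1 := (cs L).simple_mul_simple_self t
            simp [this, hlen]) h)
        simp only [hlen] at *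
        omega
      rw [if_pos h1, if_neg ht, sub_zero, hlower r _ (by simpa [hlen] using h1)]
  rw [hone, raiseR_single, raiseR_single, map_sum]
  simp only [apply_ite lower, map_zero, hterm, Finset.sum_sub_distrib]
  simp [hlen]

lemma lower_raise {k : ℕ} (hk : k ≠ 0) {f : F L} (hf : f ∈ sphere L k) :
    lower (raise f) = ((L : ℂ) - 1) • f := by
  refine eq_of_mem_sphere (A := lower ∘ₗ raise) (B := ((L : ℂ) - 1) • LinearMap.id) ?_ hf
  intro w hw
  obtain ⟨r, hr⟩ := exists_leftDescent (hw ▸ hk)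
  have h1 : ∀ s, (if len w < len (σ s * w) then lower (Finsupp.single (σ s * w) (1 : ℂ)) else 0)
      = Finsupp.single w 1 - if s = r then Finsupp.single w 1 else 0 := by
    intro s
    by_cases hs : s = r
    · subst hs
      simp [hr.le]
    · have hs' : len w < len (σ s * w) := by
        have := len_simple_mul s w
        have := mt (leftDescent_unique hr) (Ne.symm hs)
        omega
      rw [if_pos hs', if_neg hs, sub_zero, lower_single, Finset.sum_eq_single s]
      · simp [hs']
      · intro t _ ht
        exact if_neg fun h => ht (leftDescent_unique h (by simpa using hs'))
      · simp
  simp only [LinearMap.comp_apply, raise_single, map_sum, apply_ite lower, map_zero, h1]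
  simp [Finset.sum_sub_distrib, sub_smul, ← Nat.cast_smul_eq_nsmul ℂ]

lemma lowerR_raiseR {k : ℕ} (hk : k ≠ 0) {f : F L} (hf : f ∈ sphere L k) :
    lowerR (raiseR f) = ((L : ℂ) - 1) • f := by
  simp [lowerR, raiseR, flip_flip, lower_raise hk (flip_mem_sphere hf)]

/-! ### Inner products -/

open scoped Classical in
lemma inner_δ_δ (w v : W L) : ⟪δ w, δ v⟫ = if w = v then (1 : ℂ) else 0 := by
  rw [δ, δ, lp.inner_single_left]
  by_cases h : w = v
  · subst h; simp
  · rw [if_neg h]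
    simp [lp.single_apply, h]

lemma toH_injective : Function.Injective (toH (L := L)) := by
  have h : Orthonormal ℂ (δ (L := L)) := by
    classical
    exact orthonormal_iff_ite.2 inner_δ_δ
  exact h.linearIndependent

lemma inner_toH_adjoint {A B : F L →ₗ[ℂ] F L}
    (h : ∀ w v : W L, ⟪toH (A (Finsupp.single w 1)), δ v⟫ = ⟪δ w, toH (B (Finsupp.single v 1))⟫)
    (f g : F L) : ⟪toH (A f), toH g⟫ = ⟪toH f, toH (B g)⟫ := by
  induction f using Finsupp.induction_linear with
  | zero => simp
  | add f f' hf hf' => simp only [map_add, inner_add_left, hf, hf']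
  | single w c =>
    induction g using Finsupp.induction_linear with
    | zero => simp
    | add g g' hg hg' => simp only [map_add, inner_add_right, hg, hg']
    | single v d =>
      rw [← mul_one c, ← mul_one d, ← smul_eq_mul, ← smul_eq_mul, ← Finsupp.smul_single,
        ← Finsupp.smul_single]
      simp only [map_smul, inner_smul_left, inner_smul_right, toH_single, h]

lemma inner_toH_raise (f g : F L) : ⟪toH (raise f), toH g⟫ = ⟪toH f, toH (lower g)⟫ := by
  refine inner_toH_adjoint (fun w v => ?_) f g
  classical
  rw [raise_single, lower_single, map_sum, map_sum, sum_inner, inner_sum]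
  refine Finset.sum_congr rfl fun s _ => ?_
  simp only [apply_ite toH, toH_single, map_zero, apply_ite (inner ℂ · (δ v)),
    apply_ite (inner ℂ (δ w)), inner_zero_left, inner_zero_right, inner_δ_δ, ← ite_and]
  refine if_congr ⟨?_, ?_⟩ rfl rfl
  · rintro ⟨h, h'⟩
    subst h'
    simpa using h
  · rintro ⟨h, h'⟩
    subst h'
    simpa using h

lemma inner_toH_flip (f g : F L) : ⟪toH (flip f), toH g⟫ = ⟪toH f, toH (flip g)⟫ := by
  refine inner_toH_adjoint (fun w v => ?_) f g
  classical
  simp [inner_δ_δ, inv_eq_iff_eq_inv]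

lemma inner_toH_raiseR (f g : F L) : ⟪toH (raiseR f), toH g⟫ = ⟪toH f, toH (lowerR g)⟫ := by
  simp [raiseR, lowerR, inner_toH_flip, inner_toH_raise]

lemma inner_toH_raise_raise {k : ℕ} (hk : k ≠ 0) (f : F L) {g : F L} (hg : g ∈ sphere L k) :
    ⟪toH (raise f), toH (raise g)⟫ = ((L : ℂ) - 1) * ⟪toH f, toH g⟫ := by
  rw [inner_toH_raise, lower_raise hk hg, map_smul, inner_smul_right]

lemma inner_toH_raiseR_raiseR {k : ℕ} (hk : k ≠ 0) (f : F L) {g : F L} (hg : g ∈ sphere L k) :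
    ⟪toH (raiseR f), toH (raiseR g)⟫ = ((L : ℂ) - 1) * ⟪toH f, toH g⟫ := by
  rw [inner_toH_raiseR, lowerR_raiseR hk hg, map_smul, inner_smul_right]

lemma lower_raiseR_pow_succ {l : ℕ} (hl : 1 ≤ l) {f : F L} (hf : f ∈ sphere L l)
    (h0 : lower f = 0) (n : ℕ) :
    lower ((raiseR ^ (n + 1)) f) = if l = 1 then - (raiseR ^ n) f else 0 := by
  induction n with
  | zero =>
    by_cases h : l = 1
    · subst h
      simp [lower_raiseR_of_eq_one hf, h0]
    · simp [lower_raiseR_of_two_le (by omega : 2 ≤ l) hf, h0, h]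
  | succ n ih =>
    rw [pow_succ', Module.End.mul_apply,
      lower_raiseR_of_two_le (by omega) (raiseR_pow_mem_sphere hf (n + 1)), ih]
    split_ifs
    · rw [map_neg, pow_succ', Module.End.mul_apply]
    · exact map_zero _

lemma inner_raiseR_pow_raise_pow {l : ℕ} (hl : 1 ≤ l) {f f' : F L} (hf : f ∈ sphere L l)
    (hlow : lower f = 0) (hlow' : lowerR f' = 0) (h : ⟪toH f, toH f'⟫ = 0) (n r : ℕ) :
    ⟪toH ((raiseR ^ n) f), toH ((raise ^ r) f')⟫ = 0 := by
  induction n generalizing r with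
  | zero =>
    cases r with
    | zero => simpa using h
    | succ r =>
      rw [← inner_conj_symm, pow_succ', Module.End.mul_apply, inner_toH_raise]
      simp [hlow]
  | succ n ih =>
    cases r with
    | zero =>
      rw [pow_succ', Module.End.mul_apply, inner_toH_raiseR]
      simp [hlow']
    | succ r =>
      rw [← inner_conj_symm, pow_succ' raise, Module.End.mul_apply, inner_toH_raise,
        lower_raiseR_pow_succ hl hf hlow]
      split_ifs
      · rw [map_neg, inner_neg_right, map_neg, inner_conj_symm, ih, neg_zero]
      · simp

/-- The orthogonality of the families generated by two orthogonal vectors annihilated by the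
lowering operators. -/
lemma inner_raise_pow_raiseR_pow {l l' : ℕ} (hl : 1 ≤ l) (hl' : 1 ≤ l') {f f' : F L}
    (hf : f ∈ sphere L l) (hf' : f' ∈ sphere L l')
    (h₁ : lower f = 0) (h₂ : lowerR f = 0) (h₁' : lower f' = 0) (h₂' : lowerR f' = 0)
    (h : ⟪toH f, toH f'⟫ = 0) (m n r s : ℕ) :
    ⟪toH ((raise ^ m) ((raiseR ^ n) f)), toH ((raise ^ r) ((raiseR ^ s) f'))⟫ = 0 := by
  have hswap : ∀ (i j : ℕ) (g : F L),
      (raise ^ i) ((raiseR ^ j) g) = (raiseR ^ j) ((raise ^ i) g) := fun i j g =>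
    LinearMap.congr_fun (raise_raiseR_comm.pow_pow i j).eq g
  induction m generalizing r with
  | succ m ih =>
    cases r with
    | succ r =>
      rw [pow_succ', pow_succ', Module.End.mul_apply, Module.End.mul_apply,
        inner_toH_raise_raise (by omega) _
          (raise_pow_mem_sphere (raiseR_pow_mem_sphere hf' s) r), ih, mul_zero]
    | zero =>
      clear ih
      induction n generalizing s with
      | zero =>
        rw [← inner_conj_symm, map_eq_zero]
        simpa using inner_raiseR_pow_raise_pow hl' hf' h₁' h₂
          (by rw [← inner_conj_symm, h, map_zero]) s (m + 1)
      | succ n ih =>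
        cases s with
        | zero =>
          rw [hswap, pow_succ', Module.End.mul_apply, inner_toH_raiseR]
          simp [h₂']
        | succ s =>
          rw [hswap, hswap, pow_succ' raiseR, pow_succ' raiseR, Module.End.mul_apply,
            Module.End.mul_apply, inner_toH_raiseR_raiseR (by omega) _
              (raiseR_pow_mem_sphere (raise_pow_mem_sphere hf' 0) s), ← hswap, ← hswap, ih,
            mul_zero]
  | zero =>
    induction n generalizing s with
    | zero =>
      cases r with
      | succ r =>
        rw [← inner_conj_symm, pow_succ', Module.End.mul_apply, inner_toH_raise]
        simp [h₁]
      | zero =>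
        cases s with
        | zero => simpa using h
        | succ s =>
          rw [← inner_conj_symm, pow_zero, pow_succ', Module.End.one_apply, Module.End.mul_apply,
            inner_toH_raiseR]
          simp [h₂]
    | succ n ih =>
      cases s with
      | zero =>
        simpa using inner_raiseR_pow_raise_pow hl hf h₁ h₂' h (n + 1) r
      | succ s =>
        rw [hswap, hswap, pow_succ' raiseR, pow_succ' raiseR, Module.End.mul_apply,
          Module.End.mul_apply, inner_toH_raiseR_raiseR (by omega) _
            (raiseR_pow_mem_sphere (raise_pow_mem_sphere hf' r) s), ← hswap, ← hswap, ih,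
          mul_zero]

lemma lower_eq_zero {f : F L} (h : ⟪toH f, toH (raise (lower f))⟫ = 0) : lower f = 0 := by
  rw [← inner_conj_symm, inner_toH_raise, map_eq_zero, inner_self_eq_zero] at h
  exact toH_injective (by rw [h, map_zero])

lemma lowerR_eq_zero {f : F L} (h : ⟪toH f, toH (raiseR (lowerR f))⟫ = 0) : lowerR f = 0 := by
  rw [← inner_conj_symm, inner_toH_raiseR, map_eq_zero, inner_self_eq_zero] at h
  exact toH_injective (by rw [h, map_zero])

/-! ### Sums over spheres -/

instance fintype_sphere (n : ℕ) : Fintype {w : W L // len w = n} := Fintype.ofFinite _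

lemma sum_sphere_succ {M : Type*} [AddCommMonoid M] (m : ℕ) (g : W L → M) :
    ∑ w : {w : W L // len w = m + 1}, g w = ∑ w : {w : W L // len w = m}, ∑ s,
      if len w.1 < len (σ s * w.1) then g (σ s * w.1) else 0 := by
  rw [← Fintype.sum_prod_type' (fun (w : {w : W L // len w = m}) s =>
    if len w.1 < len (σ s * w.1) then g (σ s * w.1) else 0), ← Finset.sum_filter]
  symm
  refine Finset.sum_bij (fun x hx => ⟨σ x.2 * x.1, ?_⟩) ?_ ?_ ?_ ?_
  · have := len_simple_mul x.2 (x.1 : W L)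
    have := x.1.2
    simp only [Finset.mem_filter] at hx
    omega
  · simp
  · rintro ⟨⟨w, hw⟩, s⟩ hx ⟨⟨v, hv⟩, t⟩ hy hxy
    simp only [Finset.mem_filter, Finset.mem_univ, true_and, Subtype.mk.injEq] at hx hy hxy
    have hst : s = t := leftDescent_unique (w := σ s * w) (by simpa using hx)
      (by rw [hxy]; simpa using hy)
    subst hst
    have := mul_left_cancel hxy
    subst this
    rfl
  · rintro ⟨w, hw⟩ -
    obtain ⟨s, hs⟩ := exists_leftDescent (w := w) (by omega)
    refine ⟨⟨⟨σ s * w, by have := len_simple_mul s w; omega⟩, s⟩, ?_, ?_⟩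
    · simpa using hs
    · simp
  · simp

lemma raise_pow_single (m : ℕ) (x : W L) : (raise ^ m) (Finsupp.single x (1 : ℂ)) =
    ∑ w : {w : W L // len w = m},
      if len ((w : W L) * x) = m + len x then Finsupp.single ((w : W L) * x) (1 : ℂ) else 0 := by
  induction m with
  | zero =>
    have hw : ∀ w : {w : W L // len w = 0}, w = ⟨1, len_one⟩ := fun w =>
      Subtype.ext (len_eq_zero_iff.1 w.2)
    rw [Finset.sum_eq_single ⟨1, len_one⟩ (fun w _ h => absurd (hw w) h) (by simp)]
    simp
  | succ m ih =>
    rw [sum_sphere_succ m fun w => if len (w * x) = m + 1 + len x then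
      Finsupp.single (w * x) (1 : ℂ) else 0, pow_succ', Module.End.mul_apply, ih, map_sum]
    refine Finset.sum_congr rfl fun ⟨w, hw⟩ _ => ?_
    dsimp only
    rw [apply_ite raise, map_zero, raise_single]
    by_cases h : len (w * x) = m + len x
    · rw [if_pos h]
      refine Finset.sum_congr rfl fun s _ => ?_
      rw [← ite_and, mul_assoc]
      refine if_congr ?_ rfl rfl
      have h1 := len_simple_mul s w
      have h2 := len_simple_mul s (w * x)
      have h3 := len_mul_le (σ s * w) x
      rw [mul_assoc] at h3
      omega
    · rw [if_neg h]
      symm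
      refine Finset.sum_eq_zero fun s _ => ?_
      rw [← ite_and, mul_assoc]
      refine if_neg ?_
      have h1 := len_simple_mul s (w * x)
      have h2 := len_mul_le w x
      omega

/-! ### Leading terms of the Hecke operators -/

/-- The span of the vectors `d w` over the elements `w` of length less than `k`. -/
def low (d : W L → H L) (k : ℕ) : Submodule ℂ (H L) := Submodule.span ℂ (d '' {w | len w < k})

lemma mem_low {d : W L → H L} {k : ℕ} {w : W L} (h : len w < k) : d w ∈ low d k :=
  Submodule.subset_span ⟨w, h, rfl⟩

lemma low_mono (d : W L → H L) {j k : ℕ} (h : j ≤ k) : low d j ≤ low d k :=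
  Submodule.span_mono (Set.image_mono fun _ hw => lt_of_lt_of_le hw h)

lemma map_mem_low {d e : W L → H L} {A : H L →L[ℂ] H L} {j k : ℕ}
    (h : ∀ w, len w < k → A (d w) ∈ low e j) {x : H L} (hx : x ∈ low d k) : A x ∈ low e j := by
  suffices low d k ≤ (low e j).comap (A : H L →ₗ[ℂ] H L) from this hx
  rw [low, Submodule.span_le]
  rintro _ ⟨w, hw, rfl⟩
  exact h w hw

lemma low_comp_inv (k : ℕ) : low (fun w : W L => δ w⁻¹) k = low δ k := by
  refine le_antisymm (Submodule.span_le.2 ?_) (Submodule.span_le.2 ?_)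
  · rintro _ ⟨w, hw, rfl⟩
    exact mem_low (by simpa using hw)
  · rintro _ ⟨w, hw, rfl⟩
    have := mem_low (d := fun w : W L => δ w⁻¹) (w := w⁻¹) (k := k) (by simpa using hw)
    simpa using this

lemma linearCombination_mem_low (d : W L → H L) {k : ℕ} {f : F L} (hf : f ∈ sphere L k) :
    Finsupp.linearCombination ℂ d f ∈ low d (k + 1) :=
  map_mem_of_mem_sphere (fun w hw => by
    rw [Finsupp.linearCombination_single, one_smul]; exact mem_low (by omega)) hf

lemma toH_flip (f : F L) :
    toH (flip f) = Finsupp.linearCombination ℂ (fun w : W L => δ w⁻¹) f := by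
  induction f using Finsupp.induction_linear with
  | zero => simp
  | add f g hf hg => simp [hf, hg]
  | single w c => simp [flip, toH]

section Hecke

variable {d : W L → H L} {p : ℂ} {T : Fin L → H L →L[ℂ] H L}
  (hT : ∀ (s : Fin L) (w : W L), T s (d w) =
    if len (σ s * w) < len w then d (σ s * w) + p • d w else d (σ s * w))

include hT

lemma generator_mem_low (s : Fin L) {k : ℕ} {x : H L} (hx : x ∈ low d k) :
    T s x ∈ low d (k + 1) := by
  refine map_mem_low (fun w hw => ?_) hx
  have := len_simple_mul s w
  rw [hT]
  split_ifs
  · exact add_mem (mem_low (by omega)) (Submodule.smul_mem _ _ (mem_low (by omega)))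
  · exact mem_low (by omega)

lemma hecke_sub_mem_low {Tw : W L → H L →L[ℂ] H L} (hTw1 : Tw 1 = 1)
    (hTwrec : ∀ (s : Fin L) (w : W L), len (σ s * w) < len w → Tw w = T s ∘L Tw (σ s * w))
    (x : W L) {m : ℕ} {w : W L} (hw : len w = m) :
    Tw w (d x) - (if len (w * x) = m + len x then d (w * x) else 0) ∈ low d (m + len x) := by
  induction m generalizing w with
  | zero =>
    obtain rfl := len_eq_zero_iff.1 hw
    simp [hTw1]
  | succ m ih =>
    obtain ⟨s, hs⟩ := exists_leftDescent (w := w) (by omega)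
    have h1 := len_simple_mul s w
    have h2 := len_simple_mul s (w * x)
    have h3 := len_mul_le (σ s * w) x
    have h4 := generator_mem_low hT s (ih (w := σ s * w) (by omega))
    rw [map_sub, mul_assoc] at h4
    rw [mul_assoc] at h3
    rw [hTwrec s w hs, ContinuousLinearMap.comp_apply, add_right_comm]
    suffices h5 : T s (if len (σ s * (w * x)) = m + len x then d (σ s * (w * x)) else 0) -
        (if len (w * x) = m + len x + 1 then d (w * x) else 0) ∈ low d (m + len x + 1) by
      have h6 := add_mem h4 h5
      rwa [sub_add_sub_cancel] at h6
    by_cases h : len (σ s * (w * x)) = m + len x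
    · rw [if_pos h, hT, simple_mul_cancel]
      split_ifs with h5 h6 h6
      · omega
      · rw [sub_zero]
        exact add_mem (mem_low (by omega)) (Submodule.smul_mem _ _ (mem_low (by omega)))
      · simp
      · omega
    · rw [if_neg h, if_neg (by omega)]
      simp

lemma sum_generators_sub_mem_low {k : ℕ} {f : F L} (hf : f ∈ sphere L k) :
    (∑ s, T s) (Finsupp.linearCombination ℂ d f) - Finsupp.linearCombination ℂ d (raise f) ∈
      low d (k + 1) := by
  refine map_mem_of_mem_sphere (A := ((∑ s, T s : H L →L[ℂ] H L) : H L →ₗ[ℂ] H L) ∘ₗ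
    Finsupp.linearCombination ℂ d - Finsupp.linearCombination ℂ d ∘ₗ raise) (fun w hw => ?_) hf
  simp only [LinearMap.sub_apply, LinearMap.comp_apply, Finsupp.linearCombination_single, one_smul,
    raise_single, map_sum, ContinuousLinearMap.coe_coe, _root_.sum_apply,
    ← Finset.sum_sub_distrib]
  refine Submodule.sum_mem _ fun s _ => ?_
  have := len_simple_mul s w
  rw [hT]
  split_ifs with h1 h2 h2
  · omega
  · rw [map_zero, sub_zero]
    exact add_mem (mem_low (by omega)) (Submodule.smul_mem _ _ (mem_low (by omega)))
  · simp
  · omega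

variable {Tw : W L → H L →L[ℂ] H L} (hTw1 : Tw 1 = 1)
  (hTwrec : ∀ (s : Fin L) (w : W L), len (σ s * w) < len w → Tw w = T s ∘L Tw (σ s * w))

include hTw1 hTwrec

lemma sum_hecke_sub_mem_low (m : ℕ) {k : ℕ} {f : F L} (hf : f ∈ sphere L k) :
    (∑ w : {w : W L // len w = m}, Tw w) (Finsupp.linearCombination ℂ d f) -
      Finsupp.linearCombination ℂ d ((raise ^ m) f) ∈ low d (m + k) := by
  refine map_mem_of_mem_sphere
    (A := ((∑ w : {w : W L // len w = m}, Tw w : H L →L[ℂ] H L) : H L →ₗ[ℂ] H L) ∘ₗ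
      Finsupp.linearCombination ℂ d - Finsupp.linearCombination ℂ d ∘ₗ (raise ^ m))
    (fun x hx => ?_) hf
  simp only [LinearMap.sub_apply, LinearMap.comp_apply, Finsupp.linearCombination_single, one_smul,
    raise_pow_single, map_sum, ContinuousLinearMap.coe_coe, _root_.sum_apply,
    ← Finset.sum_sub_distrib]
  refine Submodule.sum_mem _ fun w _ => ?_
  have := hecke_sub_mem_low hT hTw1 hTwrec x w.2
  rw [hx] at this
  rw [hx, apply_ite (Finsupp.linearCombination ℂ d), map_zero, Finsupp.linearCombination_single,
    one_smul]
  exact this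

lemma sum_hecke_mem_low (m : ℕ) {k : ℕ} {x : H L} (hx : x ∈ low d k) :
    (∑ w : {w : W L // len w = m}, Tw w) x ∈ low d (m + k) := by
  refine map_mem_low (fun w hw => ?_) hx
  have h0 := single_mem_sphere (rfl : len w = len w)
  have h1 := sum_hecke_sub_mem_low hT hTw1 hTwrec m h0
  have h2 := linearCombination_mem_low d (raise_pow_mem_sphere h0 m)
  have h3 := add_mem (low_mono d (by omega) h1) (low_mono d (by omega : _ ≤ m + k) h2)
  simpa using h3

end Hecke

section Projection

variable {Q : ℕ → H L →L[ℂ] H L}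
  (hQ : ∀ (l : ℕ) (w : W L), Q l (δ w) = if len w = l then δ w else 0)

include hQ

lemma projection_low {k : ℕ} {x : H L} (hx : x ∈ low δ k) : Q k x = 0 := by
  have := map_mem_low (A := Q k) (e := δ) (j := 0) (fun w hw => by
    rw [hQ, if_neg hw.ne]; exact zero_mem _) hx
  simpa [low] using this

lemma projection_toH {k : ℕ} {f : F L} (hf : f ∈ sphere L k) : Q k (toH f) = toH f :=
  eq_of_mem_sphere (A := (Q k : H L →ₗ[ℂ] H L) ∘ₗ toH) (B := toH)
    (fun w hw => by simp [hQ, hw]) hf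

lemma projection_eq_toH {k : ℕ} {f : F L} (hf : f ∈ sphere L k) {x : H L}
    (hx : x - toH f ∈ low δ k) : Q k x = toH f := by
  have := projection_low hQ hx
  rwa [map_sub, projection_toH hQ hf, sub_eq_zero] at this

end Projection

lemma exists_toH_eq {k : ℕ} {x : H L} (hx : x ∈ V L k) : ∃ f ∈ sphere L k, toH f = x := by
  have : {x : H L | ∃ w : W L, len w = k ∧ x = δ w} = δ '' {w | len w = k} := by
    ext; simp [eq_comm]
  rw [V, this, Finsupp.mem_span_image_iff_linearCombination] at hx
  exact hx

lemma toH_mem_V {k : ℕ} {f : F L} (hf : f ∈ sphere L k) : toH f ∈ V L k :=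
  map_mem_of_mem_sphere (fun w hw => by
    rw [toH_single]; exact Submodule.subset_span ⟨w, hw, rfl⟩) hf

theorem statement17
    (L : ℕ) (hL : 3 ≤ L) (q p : ℝ) (hq : 0 < q) (hq1 : q ≤ 1)
    (hp : p = (q - 1) / Real.sqrt q)
    (T : Fin L → H L →L[ℂ] H L)
    (hT : ∀ (s : Fin L) (w : W L),
      T s (δ w) =
        if len (σ s * w) < len w then δ (σ s * w) + (p : ℂ) • δ w else δ (σ s * w))
    (h : H L →L[ℂ] H L) (hh : h = ∑ s, T s)
    (Tw : W L → H L →L[ℂ] H L) (hTw1 : Tw 1 = 1)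
    (hTwrec : ∀ (s : Fin L) (w : W L), len (σ s * w) < len w →
      Tw w = T s ∘L Tw (σ s * w))
    (hn : ℕ → H L →L[ℂ] H L)
    (hhn : ∀ n : ℕ, hn n = ∑' w : {w : W L // len w = n}, Tw (w : W L))
    (Tr : Fin L → H L →L[ℂ] H L)
    (hTr : ∀ (s : Fin L) (w : W L),
      Tr s (δ w) =
        if len (w * σ s) < len w then δ (w * σ s) + (p : ℂ) • δ w else δ (w * σ s))
    (Rh : H L →L[ℂ] H L) (hRh : Rh = ∑ s, Tr s)
    (Twr : W L → H L →L[ℂ] H L) (hTwr1 : Twr 1 = 1)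
    (hTwrrec : ∀ (s : Fin L) (w : W L), len (w * σ s) < len w →
      Twr w = Tr s ∘L Twr (w * σ s))
    (hnr : ℕ → H L →L[ℂ] H L)
    (hhnr : ∀ n : ℕ, hnr n = ∑' w : {w : W L // len w = n}, Twr (w : W L))
    (Q : ℕ → H L →L[ℂ] H L)
    (hQ : ∀ (l : ℕ) (w : W L), Q l (δ w) = if len w = l then δ w else 0)
    (l l' : ℕ) (hl : 1 ≤ l) (hl' : 1 ≤ l')
    (ξ : H L)
    (hξmem : ξ ∈ V L l)
    (hξperp : ∀ y ∈ Sl L Q h Rh l, ⟪ξ, y⟫ = 0)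
    (ξ' : H L)
    (hξ'mem : ξ' ∈ V L l')
    (hξ'perp : ∀ y ∈ Sl L Q h Rh l', ⟪ξ', y⟫ = 0)
    (hortho : ⟪ξ, ξ'⟫ = 0)
    (m n r s : ℕ) :
    ⟪Q (m + n + l) (hn m (hnr n ξ)), Q (r + s + l') (hn r (hnr s ξ'))⟫ = 0 := by
  have hTr' : ∀ (s : Fin L) (w : W L), Tr s (δ w⁻¹) =
      if len (σ s * w) < len w then δ (σ s * w)⁻¹ + (p : ℂ) • δ w⁻¹ else δ (σ s * w)⁻¹ := by
    intro s w
    rw [hTr, len_inv, ← len_inv (w⁻¹ * σ s)]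
    simp
  have hTwrrec' : ∀ (s : Fin L) (w : W L), len (σ s * w) < len w →
      Twr w⁻¹ = Tr s ∘L Twr (σ s * w)⁻¹ := by
    intro s w hw
    rw [hTwrrec s w⁻¹ (by rw [← len_inv (w⁻¹ * σ s)]; simpa using hw)]
    simp
  have hTwr1' : Twr (1 : W L)⁻¹ = 1 := by rw [inv_one, hTwr1]
  have hhn' : ∀ k, hn k = ∑ w : {w : W L // len w = k}, Tw w := fun k => by
    rw [hhn, tsum_fintype]
  have hhnr' : ∀ k, hnr k = ∑ w : {w : W L // len w = k}, Twr (w : W L)⁻¹ := fun k => by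
    rw [hhnr, tsum_fintype]
    exact (Equiv.sum_comp ((Equiv.inv (W L)).subtypeEquiv fun w => by simp)
      fun w : {w : W L // len w = k} => Twr w).symm
  -- The leading term of `hn m (hnr n ξ)` is obtained by raising on both sides.
  have hright : ∀ {k : ℕ} {f : F L}, f ∈ sphere L k → ∀ n,
      hnr n (toH f) - toH ((raiseR ^ n) f) ∈ low δ (n + k) := by
    intro k f hf n
    have h1 := sum_hecke_sub_mem_low (Tw := fun w => Twr w⁻¹) hTr' hTwr1' hTwrrec' n
      (flip_mem_sphere hf)
    rwa [low_comp_inv, ← toH_flip, ← toH_flip, flip_flip, ← raiseR_pow, ← hhnr'] at h1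
  have htop : ∀ {k : ℕ} {f : F L}, f ∈ sphere L k → ∀ m n,
      Q (m + n + k) (hn m (hnr n (toH f))) = toH ((raise ^ m) ((raiseR ^ n) f)) := by
    intro k f hf m n
    have hf' := raiseR_pow_mem_sphere hf n
    rw [add_assoc]
    refine projection_eq_toH hQ (raise_pow_mem_sphere hf' m) ?_
    have h1 := sum_hecke_mem_low hT hTw1 hTwrec m (hright hf n)
    have h2 := sum_hecke_sub_mem_low hT hTw1 hTwrec m hf'
    rw [← hhn'] at h1 h2
    have h3 := add_mem h1 h2
    rwa [map_sub, ← toH, sub_add_sub_cancel] at h3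
  have hlower : ∀ {k : ℕ}, 1 ≤ k → ∀ {f : F L}, f ∈ sphere L k →
      (∀ y ∈ Sl L Q h Rh k, ⟪toH f, y⟫ = 0) → lower f = 0 ∧ lowerR f = 0 := by
    intro k hk f hf hperp
    obtain ⟨k, rfl⟩ := Nat.exists_eq_add_of_le' hk
    constructor
    · have hg := lower_mem_sphere hf
      refine lower_eq_zero (hperp _ (Submodule.subset_span (.inl ⟨_, toH_mem_V hg, ?_⟩)))
      rw [hh]
      exact (projection_eq_toH hQ (raise_mem_sphere hg) (sum_generators_sub_mem_low hT hg)).symm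
    · have hg := lowerR_mem_sphere hf
      refine lowerR_eq_zero (hperp _ (Submodule.subset_span (.inr ⟨_, toH_mem_V hg, ?_⟩)))
      have h1 := sum_generators_sub_mem_low hTr' (flip_mem_sphere hg)
      rw [low_comp_inv, ← toH_flip, ← toH_flip, flip_flip, ← hRh] at h1
      exact (projection_eq_toH hQ (raiseR_mem_sphere hg) h1).symm
  obtain ⟨f, hf, rfl⟩ := exists_toH_eq hξmem
  obtain ⟨f', hf', rfl⟩ := exists_toH_eq hξ'mem
  obtain ⟨h₁, h₂⟩ := hlower hl hf hξperp
  obtain ⟨h₁', h₂'⟩ := hlower hl' hf' hξ'perp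
  rw [htop hf, htop hf']
  exact inner_raise_pow_raiseR_pow hl hl' hf hf' h₁ h₂ h₁' h₂' hortho m n r s

end UCoxMasa
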